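/- arXiv:1403.6554 — 6 statements merged into one kernel-verified Lean document; each statement's English description precedes it below -/
import Mathlib

section
/- Let S be a nonempty, bounded, perfect, nowhere-dense subset of ℝ, and let a = inf S and b = sup S. Then there exists a countable family of pairwise disjoint open intervals (cᵢ, dᵢ), each contained in [a, b], whose union equals [a, b] \ S, and S equals the derived set (i.e., the set of accumulation points) of the set of all endpoints cᵢ and dᵢ of these intervals. -/
/-- The pairs `(c, d)` of endpoints of the bounded gaps of `S`. -/
def gapEndpoints {α : Type*} [Preorder α] (S : Set α) : Set (α × α) :=
  {p | p.1 ∈ S ∧ p.2 ∈ S ∧ p.1 < p.2 ∧ Disjoint (Set.Ioo p.1 p.2) S}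

theorem gapEndpoints_pairwiseDisjoint {α : Type*} [LinearOrder α] (S : Set α) :
    (gapEndpoints S).PairwiseDisjoint (fun p => Set.Ioo p.1 p.2) := by
  rintro ⟨c, d⟩ ⟨hc, hd, -, hcd⟩ ⟨c', d'⟩ ⟨hc', hd', -, hcd'⟩ hne
  refine Set.disjoint_left.2 fun x hx hx' => hne ?_
  have h1 : ¬ c < c' := fun h => Set.disjoint_left.1 hcd ⟨h, hx'.1.trans hx.2⟩ hc'
  have h2 : ¬ c' < c := fun h => Set.disjoint_left.1 hcd' ⟨h, hx.1.trans hx'.2⟩ hc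
  have h3 : ¬ d < d' := fun h => Set.disjoint_left.1 hcd' ⟨hx'.1.trans hx.2, h⟩ hd
  have h4 : ¬ d' < d := fun h => Set.disjoint_left.1 hcd ⟨hx.1.trans hx'.2, h⟩ hd'
  exact Prod.ext (le_antisymm (not_lt.1 h2) (not_lt.1 h1))
    (le_antisymm (not_lt.1 h4) (not_lt.1 h3))

theorem IsClosed.exists_mem_gapEndpoints {S : Set ℝ} (hS : IsClosed S) {u v z : ℝ}
    (hu : u ∈ S) (hv : v ∈ S) (huz : u ≤ z) (hzv : z ≤ v) (hz : z ∉ S) :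
    ∃ p ∈ gapEndpoints S, u ≤ p.1 ∧ p.2 ≤ v ∧ z ∈ Set.Ioo p.1 p.2 := by
  obtain ⟨c, ⟨⟨huc, hcz⟩, hcS⟩, hc⟩ :=
    (isCompact_Icc.inter_right hS).exists_isGreatest ⟨u, ⟨le_rfl, huz⟩, hu⟩
  obtain ⟨d, ⟨⟨hzd, hdv⟩, hdS⟩, hd⟩ :=
    (isCompact_Icc.inter_right hS).exists_isLeast ⟨v, ⟨hzv, le_rfl⟩, hv⟩
  have hcz' : c < z := hcz.lt_of_ne fun h => hz (h ▸ hcS)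
  have hzd' : z < d := hzd.lt_of_ne fun h => hz (h ▸ hdS)
  refine ⟨(c, d), ⟨hcS, hdS, hcz'.trans hzd', Set.disjoint_left.2 fun x hx hxS => ?_⟩,
    huc, hdv, hcz', hzd'⟩
  rcases le_total x z with h | h
  · exact hx.1.not_ge (hc ⟨⟨huc.trans hx.1.le, h⟩, hxS⟩)
  · exact hx.2.not_ge (hd ⟨⟨h, hx.2.le.trans hdv⟩, hxS⟩)

theorem Perfect.subset_closure_gapEndpoints {S : Set ℝ} (hS : Perfect S)
    (hnd : IsNowhereDense S) :
    S ⊆ closure {x : ℝ | ∃ p ∈ gapEndpoints S, x = p.1 ∨ x = p.2} := by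
  intro x hx
  rw [Metric.mem_closure_iff]
  intro ε hε
  obtain ⟨s, ⟨hsε, hs⟩, hsx⟩ := accPt_iff_nhds.1 (hS.acc x hx) _ (Metric.ball_mem_nhds x hε)
  have hint : interior S = ∅ := by rw [← hS.closed.closure_eq]; exact hnd
  have key : ∀ u v : ℝ, u < v → ∃ z ∈ Set.Ioo u v, z ∉ S := by
    intro u v huv
    by_contra! h
    have := interior_maximal h isOpen_Ioo
    rw [hint, Set.subset_empty_iff, Set.Ioo_eq_empty_iff] at this
    exact this huv
  rw [Metric.mem_ball, Real.dist_eq, abs_lt] at hsε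
  rcases hsx.lt_or_gt with h | h
  · obtain ⟨z, hz, hzS⟩ := key s x h
    obtain ⟨p, hp, h1, -, h3⟩ := hS.closed.exists_mem_gapEndpoints hs hx hz.1.le hz.2.le hzS
    refine ⟨p.1, ⟨p, hp, .inl rfl⟩, ?_⟩
    rw [Real.dist_eq, abs_lt]
    constructor <;> linarith [hz.2, h3.1]
  · obtain ⟨z, hz, hzS⟩ := key x s h
    obtain ⟨p, hp, -, h2, h3⟩ := hS.closed.exists_mem_gapEndpoints hx hs hz.1.le hz.2.le hzS
    refine ⟨p.2, ⟨p, hp, .inr rfl⟩, ?_⟩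
    rw [Real.dist_eq, abs_lt]
    constructor <;> linarith [hz.1, h3.2]


/-- If `S` is a nonempty, bounded, perfect, nowhere-dense subset of `ℝ` with `a = inf S`
and `b = sup S`, then there is a countable family of pairwise disjoint open intervals
contained in `[a, b]` whose union is `[a, b] \ S`, and `S` is the derived set of the
set of endpoints of these intervals. -/
theorem perfect_nowhereDense_eq_derivedSet_of_endpoints
    (S : Set ℝ) (hne : S.Nonempty) (hbd : Bornology.IsBounded S)
    (hperf : Perfect S) (hnd : IsNowhereDense S)
    (a b : ℝ) (ha : a = sInf S) (hb : b = sSup S) :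
    ∃ I : Set (ℝ × ℝ), I.Countable ∧
      (∀ p ∈ I, p.1 < p.2 ∧ Set.Ioo p.1 p.2 ⊆ Set.Icc a b) ∧
      I.PairwiseDisjoint (fun p => Set.Ioo p.1 p.2) ∧
      (⋃ p ∈ I, Set.Ioo p.1 p.2) = Set.Icc a b \ S ∧
      S = derivedSet {x : ℝ | ∃ p ∈ I, x = p.1 ∨ x = p.2} := by
  have haS : a ∈ S := ha ▸ hperf.closed.csInf_mem hne hbd.bddBelow
  have hbS : b ∈ S := hb ▸ hperf.closed.csSup_mem hne hbd.bddAbove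
  have hsub : ∀ p ∈ gapEndpoints S, Set.Ioo p.1 p.2 ⊆ Set.Icc a b := fun p hp x hx =>
    ⟨ha ▸ (csInf_le hbd.bddBelow hp.1).trans hx.1.le,
      hb ▸ hx.2.le.trans (le_csSup hbd.bddAbove hp.2.1)⟩
  refine ⟨gapEndpoints S, ?_, fun p hp => ⟨hp.2.2.1, hsub p hp⟩,
    gapEndpoints_pairwiseDisjoint S, ?_, ?_⟩
  · exact (gapEndpoints_pairwiseDisjoint S).countable_of_isOpen (fun _ _ => isOpen_Ioo)
      fun p hp => Set.nonempty_Ioo.2 hp.2.2.1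
  · refine Set.Subset.antisymm (Set.iUnion₂_subset fun p hp x hx =>
      ⟨hsub p hp hx, Set.disjoint_left.1 hp.2.2.2 hx⟩) ?_
    rintro z ⟨⟨haz, hzb⟩, hz⟩
    obtain ⟨p, hp, -, -, hzp⟩ := hperf.closed.exists_mem_gapEndpoints haS hbS haz hzb hz
    exact Set.mem_biUnion hp hzp
  · have hS := perfect_iff_eq_derivedSet.1 hperf
    refine Set.Subset.antisymm ?_ ?_
    · rw [← derivedSet_closure]
      exact hS.subset.trans (derivedSet_mono _ _ (hperf.subset_closure_gapEndpoints hnd))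
    · refine (derivedSet_mono _ S ?_).trans hS.symm.subset
      rintro x ⟨p, hp, rfl | rfl⟩
      exacts [hp.1, hp.2.1]
end

section
/- Every point of [0,1] is the midpoint of two points of the Cantor ternary set: for every x ∈ [0,1] there exist a, b ∈ C with x = (a + b)/2. -/
/-- Every point of `[0,1]` is the midpoint of two points of the `n`-th pre-Cantor set. -/
theorem exists_midpoint_preCantorSet (n : ℕ) {x : ℝ} (hx : x ∈ Set.Icc (0 : ℝ) 1) :
    ∃ a ∈ preCantorSet n, ∃ b ∈ preCantorSet n, x = (a + b) / 2 := by
  induction n generalizing x with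
  | zero => exact ⟨x, hx, x, hx, by ring⟩
  | succ n ih =>
    obtain ⟨h0, h1⟩ := hx
    rcases le_total x (1 / 3) with h | h
    · obtain ⟨a, ha, b, hb, hab⟩ := @ih (3 * x) ⟨by linarith, by linarith⟩
      exact ⟨_, .inl ⟨a, ha, rfl⟩, _, .inl ⟨b, hb, rfl⟩, by linarith⟩
    · rcases le_total x (2 / 3) with h' | h'
      · obtain ⟨a, ha, b, hb, hab⟩ := @ih (3 * x - 1) ⟨by linarith, by linarith⟩
        exact ⟨_, .inl ⟨a, ha, rfl⟩, _, .inr ⟨b, hb, rfl⟩, by linarith⟩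
      · obtain ⟨a, ha, b, hb, hab⟩ := @ih (3 * x - 2) ⟨by linarith, by linarith⟩
        exact ⟨_, .inr ⟨a, ha, rfl⟩, _, .inr ⟨b, hb, rfl⟩, by linarith⟩

/-- Every point of `[0,1]` is the midpoint of two points of the Cantor ternary set. -/
theorem midpoint_cantorSet :
    ∀ x ∈ Set.Icc (0 : ℝ) 1, ∃ a ∈ cantorSet, ∃ b ∈ cantorSet, x = (a + b) / 2 := by
  intro x hx
  let K : ℕ → Set ℝ := fun n ↦ preCantorSet n ∩ (fun a ↦ 2 * x - a) ⁻¹' preCantorSet n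
  have hclosed (n : ℕ) : IsClosed (K n) :=
    (isClosed_preCantorSet n).inter ((isClosed_preCantorSet n).preimage (by fun_prop))
  have hne (n : ℕ) : (K n).Nonempty := by
    obtain ⟨a, ha, b, hb, hab⟩ := exists_midpoint_preCantorSet n hx
    refine ⟨a, ha, ?_⟩
    rwa [Set.mem_preimage, show 2 * x - a = b by linarith]
  have hanti (n : ℕ) : K (n + 1) ⊆ K n := fun a ha ↦
    ⟨preCantorSet_antitone n.le_succ ha.1, preCantorSet_antitone n.le_succ ha.2⟩
  have hcompact : IsCompact (K 0) :=
    isCompact_Icc.of_isClosed_subset (hclosed 0) Set.inter_subset_left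
  obtain ⟨a, ha⟩ := IsCompact.nonempty_iInter_of_sequence_nonempty_isCompact_isClosed
    K hanti hne hcompact hclosed
  rw [Set.mem_iInter] at ha
  exact ⟨a, Set.mem_iInter.mpr fun n ↦ (ha n).1, 2 * x - a,
    Set.mem_iInter.mpr fun n ↦ (ha n).2, by ring⟩
end

section
/- There exists exactly one continuous function G : [0,1] → ℝ satisfying the self-similarity system: G(x) = (1/2)G(3x) for 0 ≤ x ≤ 1/3, G(x) = 1/2 for 1/3 ≤ x ≤ 2/3, and G(x) = (1/2)G(3x − 2) + 1/2 for 2/3 ≤ x ≤ 1. -/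
/-- The approximants of the Cantor function: iterates of `f ↦ (f (3x) + f (3x - 2)) / 2`,
started from the truncation of the identity to `[0,1]`. -/
noncomputable def cantorApprox : ℕ → ℝ → ℝ
  | 0, x => max 0 (min 1 x)
  | n + 1, x => (cantorApprox n (3 * x) + cantorApprox n (3 * x - 2)) / 2

theorem continuous_cantorApprox (n : ℕ) : Continuous (cantorApprox n) := by
  induction n with
  | zero => exact continuous_const.max (continuous_const.min continuous_id)
  | succ n ih =>
    change Continuous fun x => (cantorApprox n (3 * x) + cantorApprox n (3 * x - 2)) / 2
    fun_prop

theorem cantorApprox_of_nonpos (n : ℕ) {x : ℝ} (hx : x ≤ 0) : cantorApprox n x = 0 := by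
  induction n generalizing x with
  | zero =>
    rw [cantorApprox]
    exact max_eq_left ((min_le_right 1 x).trans hx)
  | succ n ih => rw [cantorApprox, ih (by linarith), ih (by linarith)]; norm_num

theorem cantorApprox_of_one_le (n : ℕ) {x : ℝ} (hx : 1 ≤ x) : cantorApprox n x = 1 := by
  induction n generalizing x with
  | zero => rw [cantorApprox, min_eq_left hx, max_eq_right zero_le_one]
  | succ n ih => rw [cantorApprox, ih (by linarith), ih (by linarith)]; norm_num

theorem cantorApprox_mem_Icc (n : ℕ) (x : ℝ) : cantorApprox n x ∈ Set.Icc (0 : ℝ) 1 := by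
  induction n generalizing x with
  | zero => exact ⟨le_max_left _ _, max_le zero_le_one (min_le_left _ _)⟩
  | succ n ih =>
    obtain ⟨h₁, h₂⟩ := ih (3 * x)
    obtain ⟨h₃, h₄⟩ := ih (3 * x - 2)
    rw [cantorApprox]
    constructor <;> linarith

theorem dist_cantorApprox_succ_le (n : ℕ) (x : ℝ) :
    dist (cantorApprox n x) (cantorApprox (n + 1) x) ≤ 1 * (1 / 2) ^ n := by
  induction n generalizing x with
  | zero =>
    simpa using Real.dist_le_of_mem_Icc_01 (cantorApprox_mem_Icc 0 x) (cantorApprox_mem_Icc 1 x)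
  | succ n ih =>
    rw [cantorApprox.eq_2 x n, cantorApprox.eq_2 x (n + 1), pow_succ]
    rcases le_total x (2 / 3) with hx | hx
    · have h := ih (3 * x)
      rw [cantorApprox_of_nonpos n (show 3 * x - 2 ≤ 0 by linarith),
        cantorApprox_of_nonpos (n + 1) (show 3 * x - 2 ≤ 0 by linarith)]
      rw [Real.dist_eq, abs_le] at h ⊢
      constructor <;> linarith
    · have h := ih (3 * x - 2)
      rw [cantorApprox_of_one_le n (show 1 ≤ 3 * x by linarith),
        cantorApprox_of_one_le (n + 1) (show 1 ≤ 3 * x by linarith)]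
      rw [Real.dist_eq, abs_le] at h ⊢
      constructor <;> linarith

open Filter Topology in
theorem exists_continuous_eq_half_add_half :
    ∃ G : ℝ → ℝ, Continuous G ∧ (∀ x ≤ 0, G x = 0) ∧ (∀ x, 1 ≤ x → G x = 1) ∧
      ∀ x, G x = (G (3 * x) + G (3 * x - 2)) / 2 := by
  have hlim (x : ℝ) : ∃ y, Tendsto (fun n => cantorApprox n x) atTop (𝓝 y) :=
    cauchySeq_tendsto_of_complete <|
      cauchySeq_of_le_geometric (1 / 2) 1 (by norm_num) fun n => dist_cantorApprox_succ_le n x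
  choose G hG using hlim
  have hunif : TendstoUniformly cantorApprox G atTop := by
    rw [Metric.tendstoUniformly_iff]
    intro ε hε
    have h0 : Tendsto (fun n : ℕ => 1 * (1 / 2 : ℝ) ^ n / (1 - 1 / 2)) atTop (𝓝 0) := by
      simpa using ((tendsto_pow_atTop_nhds_zero_of_lt_one (r := (1 / 2 : ℝ)) (by norm_num)
        (by norm_num)).const_mul 1).div_const (1 - 1 / 2)
    filter_upwards [h0.eventually_lt_const hε] with n hn x
    rw [dist_comm]
    exact (dist_le_of_le_geometric_of_tendsto (1 / 2) 1 (by norm_num)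
      (fun n => dist_cantorApprox_succ_le n x) (hG x) n).trans_lt hn
  refine ⟨G, hunif.continuous (Frequently.of_forall continuous_cantorApprox),
    fun x hx => ?_, fun x hx => ?_, fun x => ?_⟩
  · exact tendsto_nhds_unique (hG x) (by simp [cantorApprox_of_nonpos _ hx])
  · exact tendsto_nhds_unique (hG x) (by simp [cantorApprox_of_one_le _ hx])
  · exact tendsto_nhds_unique ((tendsto_add_atTop_iff_nat 1).2 (hG x))
      (((hG (3 * x)).add (hG (3 * x - 2))).div_const 2)

/-- There is exactly one function `G : [0,1] → ℝ`, continuous on `[0,1]`, satisfying the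
self-similarity system `G x = G (3x) / 2` for `0 ≤ x ≤ 1/3`, `G x = 1/2` for
`1/3 ≤ x ≤ 2/3`, and `G x = G (3x - 2) / 2 + 1/2` for `2/3 ≤ x ≤ 1`. -/
theorem existsUnique_cantor_function_selfSimilar :
    ∃ G : ℝ → ℝ,
      (ContinuousOn G (Set.Icc 0 1) ∧
        (∀ x : ℝ, 0 ≤ x → x ≤ 1 / 3 → G x = G (3 * x) / 2) ∧
        (∀ x : ℝ, 1 / 3 ≤ x → x ≤ 2 / 3 → G x = 1 / 2) ∧
        (∀ x : ℝ, 2 / 3 ≤ x → x ≤ 1 → G x = G (3 * x - 2) / 2 + 1 / 2)) ∧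
      ∀ G' : ℝ → ℝ,
        (ContinuousOn G' (Set.Icc 0 1) ∧
          (∀ x : ℝ, 0 ≤ x → x ≤ 1 / 3 → G' x = G' (3 * x) / 2) ∧
          (∀ x : ℝ, 1 / 3 ≤ x → x ≤ 2 / 3 → G' x = 1 / 2) ∧
          (∀ x : ℝ, 2 / 3 ≤ x → x ≤ 1 → G' x = G' (3 * x - 2) / 2 + 1 / 2)) →
        Set.EqOn G G' (Set.Icc 0 1) := by
  obtain ⟨G, hc, h0, h1, hG⟩ := exists_continuous_eq_half_add_half
  have hl (x : ℝ) (_ : 0 ≤ x) (hx : x ≤ 1 / 3) : G x = G (3 * x) / 2 := by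
    rw [hG x, h0 (3 * x - 2) (by linarith), add_zero]
  have hm (x : ℝ) (hx : 1 / 3 ≤ x) (hx' : x ≤ 2 / 3) : G x = 1 / 2 := by
    rw [hG x, h0 (3 * x - 2) (by linarith), h1 (3 * x) (by linarith), add_zero]
  have hr (x : ℝ) (hx : 2 / 3 ≤ x) (_ : x ≤ 1) : G x = G (3 * x - 2) / 2 + 1 / 2 := by
    rw [hG x, h1 (3 * x) (by linarith)]; ring
  refine ⟨G, ⟨hc.continuousOn, hl, hm, hr⟩, ?_⟩
  rintro G' ⟨hc', hl', hm', hr'⟩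
  obtain ⟨z, ⟨hz0, hz1⟩, hz⟩ := isCompact_Icc.exists_isMaxOn
    (Set.nonempty_Icc.2 (zero_le_one' ℝ)) (hc.continuousOn.sub hc').abs
  have hmax (y : ℝ) (hy0 : 0 ≤ y) (hy1 : y ≤ 1) : |G y - G' y| ≤ |G z - G' z| := hz ⟨hy0, hy1⟩
  have hhalf : |G z - G' z| ≤ |G z - G' z| / 2 := by
    rcases le_total z (1 / 3) with h | h
    · have := hmax (3 * z) (by linarith) (by linarith)
      have e : G z - G' z = (G (3 * z) - G' (3 * z)) / 2 := by
        rw [hl z hz0 h, hl' z hz0 h]; ring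
      calc |G z - G' z| = |G (3 * z) - G' (3 * z)| / 2 := by rw [e, abs_div, abs_two]
        _ ≤ _ := by linarith
    rcases le_total z (2 / 3) with h' | h'
    · rw [hm z h h', hm' z h h']; norm_num
    · have := hmax (3 * z - 2) (by linarith) (by linarith)
      have e : G z - G' z = (G (3 * z - 2) - G' (3 * z - 2)) / 2 := by
        rw [hr z h' hz1, hr' z h' hz1]; ring
      calc |G z - G' z| = |G (3 * z - 2) - G' (3 * z - 2)| / 2 := by rw [e, abs_div, abs_two]
        _ ≤ _ := by linarith
  rintro x ⟨hx0, hx1⟩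
  have hx : |G x - G' x| ≤ 0 := by linarith [hmax x hx0 hx1]
  exact sub_eq_zero.1 (abs_nonpos_iff.1 hx)
end

section
/- Let n ≥ 3 be an integer. Define c_0 = 1 and c_k = (c_{k−1} − n^{−k})/2 for k ≥ 1 (so that at step k an open interval of length 1/n^k is removed from the center of each of the 2^{k−1} remaining closed intervals). Then the Smith–Volterra–Cantor set SVC(n) = E(c) has Lebesgue measure (n − 3)/(n − 2). -/
open MeasureTheory

/-- The set `F n` of left endpoints at stage `n` of the symmetric Cantor construction
determined by the sequence `c`: sums `∑_{j=1}^n ε_j r_j` with `ε_j ∈ {0,1}` and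
`r_j = c (j-1) - c j`. -/
def symF (c : ℕ → ℝ) (n : ℕ) : Set ℝ :=
  {t : ℝ | ∃ ε : ℕ → ℕ, (∀ j, ε j ≤ 1) ∧
    t = ∑ j ∈ Finset.Icc 1 n, (ε j : ℝ) * (c (j - 1) - c j)}

/-- Stage `n` of the symmetric Cantor construction: `E_n = ⋃_{t ∈ F_n} [t, t + c_n]`. -/
def symStage (c : ℕ → ℝ) (n : ℕ) : Set ℝ := ⋃ t ∈ symF c n, Set.Icc t (t + c n)

/-- The symmetric Cantor set `E(c) = ⋂_n E_n` determined by the sequence `c`. -/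
def symCantorSet (c : ℕ → ℝ) : Set ℝ := ⋂ n, symStage c n

/-- The stages of the construction satisfy the self-similarity recursion obtained by splitting off
the first digit. -/
theorem mem_symStage_succ (c : ℕ → ℝ) (n : ℕ) (x : ℝ) :
    x ∈ symStage c (n + 1) ↔
      x ∈ symStage (fun k => c (k + 1)) n ∨ x - (c 0 - c 1) ∈ symStage (fun k => c (k + 1)) n := by
  have sum_split (ε : ℕ → ℕ) :
      ∑ j ∈ Finset.Icc 1 (n + 1), (ε j : ℝ) * (c (j - 1) - c j) =
        ε 1 * (c 0 - c 1) +
          ∑ j ∈ Finset.Icc 1 n, (ε (j + 1) : ℝ) * (c (j - 1 + 1) - c (j + 1)) := by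
    simp only [← Finset.Ico_add_one_right_eq_Icc, Finset.sum_Ico_eq_sum_range,
      Nat.add_sub_cancel, Finset.sum_range_succ' _ n, add_comm 1, Nat.zero_add]
    ring
  simp only [symStage, symF, Set.mem_iUnion, Set.mem_ofPred_eq, Set.mem_Icc, exists_prop]
  constructor
  · rintro ⟨t, ⟨ε, hε, rfl⟩, h1, h2⟩
    rw [sum_split] at h1 h2
    rcases Nat.le_one_iff_eq_zero_or_eq_one.mp (hε 1) with h | h
    · refine Or.inl ⟨_, ⟨fun j => ε (j + 1), fun j => hε _, rfl⟩, ?_, ?_⟩ <;>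
        simp only [h, Nat.cast_zero] at h1 h2 <;> linarith
    · refine Or.inr ⟨_, ⟨fun j => ε (j + 1), fun j => hε _, rfl⟩, ?_, ?_⟩ <;>
        simp only [h, Nat.cast_one] at h1 h2 <;> linarith
  · have extend (d : ℕ) (hd : d ≤ 1) (ε : ℕ → ℕ) (hε : ∀ j, ε j ≤ 1) :
        ∃ ε' : ℕ → ℕ, (∀ j, ε' j ≤ 1) ∧
          d * (c 0 - c 1) + ∑ j ∈ Finset.Icc 1 n, (ε j : ℝ) * (c (j - 1 + 1) - c (j + 1)) =
            ∑ j ∈ Finset.Icc 1 (n + 1), (ε' j : ℝ) * (c (j - 1) - c j) := by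
      refine ⟨fun j => if j = 1 then d else ε (j - 1), fun j => ?_, ?_⟩
      · dsimp only
        split_ifs
        exacts [hd, hε _]
      · rw [sum_split]
        refine congrArg₂ (· + ·) (by simp) (Finset.sum_congr rfl fun j hj => ?_)
        have hj0 : j ≠ 0 := by have := (Finset.mem_Icc.mp hj).1; omega
        simp [hj0]
    rintro (⟨t, ⟨ε, hε, rfl⟩, h1, h2⟩ | ⟨t, ⟨ε, hε, rfl⟩, h1, h2⟩)
    · refine ⟨_, extend 0 zero_le_one ε hε, ?_, ?_⟩ <;> simp only [Nat.cast_zero] <;> linarith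
    · refine ⟨_, extend 1 le_rfl ε hε, ?_, ?_⟩ <;> simp only [Nat.cast_one] <;> linarith

theorem symStage_succ (c : ℕ → ℝ) (n : ℕ) :
    symStage c (n + 1) = symStage (fun k => c (k + 1)) n ∪
      (fun x => x - (c 0 - c 1)) ⁻¹' symStage (fun k => c (k + 1)) n :=
  Set.ext (mem_symStage_succ c n)

theorem symStage_zero (c : ℕ → ℝ) : symStage c 0 = Set.Icc 0 (c 0) := by
  ext x
  simp only [symStage, symF, Set.mem_iUnion, Set.mem_ofPred_eq, exists_prop]
  constructor
  · rintro ⟨t, ⟨ε, -, rfl⟩, h⟩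
    simpa using h
  · intro h
    exact ⟨0, ⟨0, by simp, by simp⟩, by simpa using h⟩

theorem measurableSet_symStage (c : ℕ → ℝ) (n : ℕ) : MeasurableSet (symStage c n) := by
  induction n generalizing c with
  | zero => rw [symStage_zero]; exact measurableSet_Icc
  | succ n ih =>
    rw [symStage_succ]
    exact (ih _).union (measurable_sub_const _ (ih _))

theorem symStage_subset_Icc (c : ℕ → ℝ) (hc : Antitone c) (n : ℕ) :
    symStage c n ⊆ Set.Icc 0 (c 0) := by
  induction n generalizing c with
  | zero => rw [symStage_zero]
  | succ n ih =>
    have h := ih (fun k => c (k + 1)) fun a b hab => hc (Nat.succ_le_succ hab)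
    have h01 : c 1 ≤ c 0 := hc zero_le_one
    intro x hx
    rcases (mem_symStage_succ c n x).mp hx with hx | hx <;>
      obtain ⟨h1, h2⟩ := h hx <;> constructor <;> simp only [zero_add] at h2 <;> linarith

theorem symStage_succ_subset (c : ℕ → ℝ) (hc : Antitone c) (n : ℕ) :
    symStage c (n + 1) ⊆ symStage c n := by
  induction n generalizing c with
  | zero =>
    rw [symStage_zero]
    exact symStage_subset_Icc c hc 1
  | succ n ih =>
    have h := ih (fun k => c (k + 1)) fun a b hab => hc (Nat.succ_le_succ hab)
    intro x hx
    rw [mem_symStage_succ] at hx ⊢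
    exact hx.imp (@h _) (@h _)

theorem volume_symStage (c : ℕ → ℝ) (hanti : Antitone c) (hc : ∀ k, 2 * c (k + 1) < c k) (n : ℕ) :
    volume (symStage c n) = ENNReal.ofReal (2 ^ n * c n) := by
  induction n generalizing c with
  | zero => simp [symStage_zero]
  | succ n ih =>
    have hanti' : Antitone fun k => c (k + 1) := fun a b hab => hanti (Nat.succ_le_succ hab)
    have hsub := symStage_subset_Icc _ hanti' n
    have hmeas := measurableSet_symStage (fun k => c (k + 1)) n
    have hdisj : Disjoint (symStage (fun k => c (k + 1)) n)
        ((fun x => x - (c 0 - c 1)) ⁻¹' symStage (fun k => c (k + 1)) n) := by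
      refine Set.disjoint_left.mpr fun x hx hx' => ?_
      have h1 := (hsub hx).2
      have h2 := (hsub hx').1
      have h3 := hc 0
      simp only [zero_add] at h1 h3
      linarith
    rw [symStage_succ, measure_union hdisj (measurable_sub_const _ hmeas),
      (measurePreserving_sub_right volume _).measure_preimage hmeas.nullMeasurableSet,
      ih _ hanti' fun k => hc (k + 1), ← two_mul, pow_succ', mul_assoc, ENNReal.ofReal_mul zero_le_two, ENNReal.ofReal_ofNat]

/-- The measure of the symmetric Cantor set is the limit of the measures of its stages. -/
theorem volume_symCantorSet (c : ℕ → ℝ) (hanti : Antitone c) (hc : ∀ k, 2 * c (k + 1) < c k)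
    {L : ℝ} (hL : Filter.Tendsto (fun n => 2 ^ n * c n) Filter.atTop (nhds L)) :
    volume (symCantorSet c) = ENNReal.ofReal L := by
  refine tendsto_nhds_unique (tendsto_measure_iInter_atTop
    (fun n => (measurableSet_symStage c n).nullMeasurableSet)
    (antitone_nat_of_succ_le (symStage_succ_subset c hanti)) ⟨0, ?_⟩) ?_
  · rw [volume_symStage c hanti hc]
    exact ENNReal.ofReal_ne_top
  · simpa only [Function.comp_def, volume_symStage c hanti hc] using
      (ENNReal.continuous_ofReal.tendsto L).comp hL

/-- The Smith–Volterra–Cantor set `SVC(n)`, `n ≥ 3`, obtained by removing at step `k`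
a centered open interval of length `1/n^k` from each remaining closed interval, has
Lebesgue measure `(n - 3)/(n - 2)`. -/
theorem volume_SVC (n : ℕ) (hn : 3 ≤ n) (c : ℕ → ℝ)
    (hc0 : c 0 = 1) (hc : ∀ k : ℕ, 1 ≤ k → c k = (c (k - 1) - 1 / (n : ℝ) ^ k) / 2) :
    volume (symCantorSet c) = ENNReal.ofReal (((n : ℝ) - 3) / ((n : ℝ) - 2)) := by
  have hn3 : (3 : ℝ) ≤ n := by exact_mod_cast hn
  have hn0 : (n : ℝ) ≠ 0 := by linarith
  have hn2 : (n : ℝ) - 2 ≠ 0 := by linarith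
  have hrec (k : ℕ) : c (k + 1) = (c k - 1 / (n : ℝ) ^ (k + 1)) / 2 := hc (k + 1) k.succ_pos
  have closed_form (k : ℕ) :
      2 ^ k * c k = ((n : ℝ) - 3) / (n - 2) + (2 / n) ^ k / (n - 2) := by
    induction k with
    | zero => rw [hc0]; field_simp; ring
    | succ k ih =>
      have hstep : 2 ^ (k + 1) * c (k + 1) = 2 ^ k * c k - (2 / (n : ℝ)) ^ k / n := by
        rw [hrec, div_pow]; field_simp; ring
      rw [hstep, ih, pow_succ]
      field_simp
      ring
  have hnonneg (k : ℕ) : 0 ≤ c k := by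
    have h : 0 ≤ 2 ^ k * c k := by
      rw [closed_form]
      have h2 : (0 : ℝ) ≤ n - 2 := by linarith
      have h3 : (0 : ℝ) ≤ n - 3 := by linarith
      positivity
    exact nonneg_of_mul_nonneg_right h (by positivity)
  have hgap (k : ℕ) : 2 * c (k + 1) < c k := by
    have : 0 < 1 / (n : ℝ) ^ (k + 1) := by positivity
    rw [hrec]
    linarith
  refine volume_symCantorSet c
    (antitone_nat_of_succ_le fun k => by linarith [hgap k, hnonneg (k + 1)]) hgap ?_
  have hpow : Filter.Tendsto (fun k => (2 / (n : ℝ)) ^ k) Filter.atTop (nhds 0) :=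
    tendsto_pow_atTop_nhds_zero_of_lt_one (by positivity)
      ((div_lt_one (by linarith)).mpr (by linarith))
  simpa [closed_form] using (hpow.div_const ((n : ℝ) - 2)).const_add (((n : ℝ) - 3) / (n - 2))
end

section
/- Let 0 < β < 1. Define c_0 = 1 and c_k = c_{k−1}(1 − β)/2 for k ≥ 1, i.e., c_k = ((1−β)/2)^k. Then the middle-β Cantor set C^β = E(c) has Hausdorff dimension log 2 / (log 2 − log(1 − β)). -/
open MeasureTheory

open Set Filter Topology

/-- The point of the symmetric Cantor set of ratio `a` whose binary address is `d`. -/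
noncomputable def cantorPoint (a : ℝ) (d : ℕ → Fin 2) : ℝ :=
  ∑' i, ((d i : ℕ) : ℝ) * (a ^ i * (1 - a))

section CantorPoint

variable {a : ℝ}

theorem digit_le_one (x : Fin 2) : ((x : ℕ) : ℝ) ≤ 1 := by
  exact_mod_cast Nat.lt_succ_iff.mp x.isLt

theorem hasSum_geometric_mul_one_sub (h0 : 0 < a) (h1 : a < 1) :
    HasSum (fun i : ℕ => a ^ i * (1 - a)) 1 := by
  have h := (hasSum_geometric_of_lt_one h0.le h1).mul_right (1 - a)
  rwa [inv_mul_cancel₀ (by linarith)] at h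

theorem cantorTerm_le (h0 : 0 < a) (h1 : a < 1) (d : ℕ → Fin 2) (i : ℕ) :
    ((d i : ℕ) : ℝ) * (a ^ i * (1 - a)) ≤ a ^ i * (1 - a) :=
  mul_le_of_le_one_left (mul_nonneg (pow_pos h0 i).le (by linarith)) (digit_le_one _)

theorem cantorTerm_nonneg (h0 : 0 < a) (h1 : a < 1) (d : ℕ → Fin 2) (i : ℕ) :
    0 ≤ ((d i : ℕ) : ℝ) * (a ^ i * (1 - a)) :=
  mul_nonneg (Nat.cast_nonneg _) (mul_nonneg (pow_pos h0 i).le (by linarith))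

theorem summable_cantorTerm (h0 : 0 < a) (h1 : a < 1) (d : ℕ → Fin 2) :
    Summable fun i => ((d i : ℕ) : ℝ) * (a ^ i * (1 - a)) :=
  (hasSum_geometric_mul_one_sub h0 h1).summable.of_nonneg_of_le
    (cantorTerm_nonneg h0 h1 d) (cantorTerm_le h0 h1 d)

theorem cantorPoint_nonneg (h0 : 0 < a) (h1 : a < 1) (d : ℕ → Fin 2) : 0 ≤ cantorPoint a d :=
  tsum_nonneg (cantorTerm_nonneg h0 h1 d)

theorem cantorPoint_le_one (h0 : 0 < a) (h1 : a < 1) (d : ℕ → Fin 2) : cantorPoint a d ≤ 1 :=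
  (hasSum_geometric_mul_one_sub h0 h1).tsum_eq ▸
    (summable_cantorTerm h0 h1 d).tsum_le_tsum (cantorTerm_le h0 h1 d)
      (hasSum_geometric_mul_one_sub h0 h1).summable

theorem cantorPoint_eq_sum_add (h0 : 0 < a) (h1 : a < 1) (d : ℕ → Fin 2) (n : ℕ) :
    cantorPoint a d = ∑ i ∈ Finset.range n, ((d i : ℕ) : ℝ) * (a ^ i * (1 - a)) +
      a ^ n * cantorPoint a fun i => d (i + n) := by
  rw [cantorPoint, ← (summable_cantorTerm h0 h1 d).sum_add_tsum_nat_add n, cantorPoint,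
    ← tsum_mul_left]
  congr 2
  ext i
  ring

/-- Points whose addresses first differ at position `n` are at least `(1 - 2 * a) * a ^ n` apart. -/
theorem le_abs_cantorPoint_sub (h0 : 0 < a) (h1 : a < 1 / 2) {x y : ℕ → Fin 2} {n : ℕ}
    (hlt : ∀ i < n, x i = y i) (hne : x n ≠ y n) :
    (1 - 2 * a) * a ^ n ≤ |cantorPoint a x - cantorPoint a y| := by
  wlog hxy : y n < x n generalizing x y
  · rw [abs_sub_comm]
    exact this (fun i hi => (hlt i hi).symm) hne.symm (lt_of_le_of_ne (not_lt.mp hxy) hne)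
  have ha : a < 1 := by linarith
  have hy : y n = 0 := by lia
  have hx : x n = 1 := by lia
  have hsum : ∑ i ∈ Finset.range n, ((x i : ℕ) : ℝ) * (a ^ i * (1 - a)) =
      ∑ i ∈ Finset.range n, ((y i : ℕ) : ℝ) * (a ^ i * (1 - a)) :=
    Finset.sum_congr rfl fun i hi => by rw [hlt i (Finset.mem_range.mp hi)]
  refine le_trans ?_ (le_abs_self _)
  rw [cantorPoint_eq_sum_add h0 ha x (n + 1), cantorPoint_eq_sum_add h0 ha y (n + 1),
    Finset.sum_range_succ, Finset.sum_range_succ, hsum, hx, hy]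
  have hp : 0 < a ^ (n + 1) := pow_pos h0 _
  have hX := mul_nonneg hp.le (cantorPoint_nonneg h0 ha fun i => x (i + (n + 1)))
  have hY := mul_le_of_le_one_right hp.le (cantorPoint_le_one h0 ha fun i => y (i + (n + 1)))
  have hpow : a ^ (n + 1) = a * a ^ n := pow_succ' a n
  simp only [Fin.val_one, Fin.val_zero, Nat.cast_one, Nat.cast_zero, one_mul, zero_mul]
  linarith

theorem abs_ofDigits_sub_le_rpow (h0 : 0 < a) (h1 : a < 1 / 2) {s : ℝ} (hs : 0 < s)
    (has : a ^ s = 1 / 2) (x y : ℕ → Fin 2) :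
    |Real.ofDigits x - Real.ofDigits y| ≤
      ((1 - 2 * a)⁻¹) ^ s * |cantorPoint a x - cantorPoint a y| ^ s := by
  have hb : 0 < 1 - 2 * a := by linarith
  rcases eq_or_ne x y with rfl | hxy
  · simp [Real.zero_rpow hs.ne']
  have hlt : ∀ i < PiNat.firstDiff x y, x i = y i := fun i hi => PiNat.apply_eq_of_lt_firstDiff hi
  have hle := le_abs_cantorPoint_sub h0 h1 hlt (PiNat.apply_firstDiff_ne hxy)
  set n := PiNat.firstDiff x y
  calc |Real.ofDigits x - Real.ofDigits y| ≤ ((2 : ℕ) ^ n : ℝ)⁻¹ :=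
        Real.abs_ofDigits_sub_ofDigits_le hlt
    _ = (a ^ n) ^ s := by
        rw [← Real.rpow_natCast a n, ← Real.rpow_mul h0.le, mul_comm, Real.rpow_mul h0.le, has,
          Real.rpow_natCast]
        simp
    _ ≤ ((1 - 2 * a)⁻¹ * |cantorPoint a x - cantorPoint a y|) ^ s := by
        refine Real.rpow_le_rpow (pow_pos h0 n).le ?_ hs.le
        rwa [inv_mul_eq_div, le_div_iff₀ hb, mul_comm]
    _ = _ := Real.mul_rpow (inv_pos.mpr hb).le (abs_nonneg _)

end CantorPoint

/-- If `g` is Hölder with respect to `f`, with exponent `r`, then the range of `f` has dimension at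
least `r` times that of the range of `g`. -/
theorem dimH_range_le_div_of_edist_le {ι X Y : Type*} [EMetricSpace X] [EMetricSpace Y]
    {f : ι → X} {g : ι → Y} {C r : NNReal} (hr : 0 < r)
    (h : ∀ i j, edist (g i) (g j) ≤ C * edist (f i) (f j) ^ (r : ℝ)) :
    dimH (range g) ≤ dimH (range f) / r := by
  rcases isEmpty_or_nonempty ι with hι | hι
  · simp [range_eq_empty]
  have hf : ∀ i, f (Function.invFun f (f i)) = f i := fun i => Function.invFun_eq ⟨i, rfl⟩
  have hg : ∀ i, g (Function.invFun f (f i)) = g i := fun i => by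
    have := h (Function.invFun f (f i)) i
    rw [hf, edist_self, ENNReal.zero_rpow_of_pos (by exact_mod_cast hr), mul_zero] at this
    exact edist_eq_zero.mp (le_antisymm this zero_le)
  have hH : HolderOnWith C r (fun x => g (Function.invFun f x)) (range f) := by
    rintro _ ⟨i, rfl⟩ _ ⟨j, rfl⟩
    simpa only [hg] using h i j
  have himg : range g = (fun x => g (Function.invFun f x)) '' range f := by
    rw [← range_comp]
    exact congrArg range (funext fun i => (hg i).symm)
  rw [himg]
  exact hH.dimH_image_le hr

theorem le_dimH_range_cantorPoint {a : ℝ} (h0 : 0 < a) (h1 : a < 1 / 2) {s : ℝ} (hs : 0 < s)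
    (has : a ^ s = 1 / 2) : ENNReal.ofReal s ≤ dimH (range (cantorPoint a)) := by
  have hrange : dimH (range (Real.ofDigits (b := 2))) = 1 := by
    have hsub : Icc (0 : ℝ) 1 ⊆ range (Real.ofDigits (b := 2)) := fun x hx => by
      obtain ⟨d, -, hd⟩ := Real.ofDigits_SurjOn one_lt_two hx
      exact ⟨d, hd⟩
    rw [Real.dimH_of_nonempty_interior]
    · simp
    · exact Nonempty.mono (interior_mono hsub) (by simp)
  have hle := dimH_range_le_div_of_edist_le (f := cantorPoint a) (g := Real.ofDigits (b := 2))
    (C := (((1 - 2 * a)⁻¹) ^ s).toNNReal) (r := s.toNNReal) (Real.toNNReal_pos.mpr hs)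
    fun x y => by
      rw [edist_dist, edist_dist, Real.dist_eq, Real.dist_eq, Real.coe_toNNReal s hs.le,
        ENNReal.ofReal_rpow_of_nonneg (abs_nonneg _) hs.le]
      change _ ≤ ENNReal.ofReal _ * _
      rw [← ENNReal.ofReal_mul (Real.rpow_nonneg (inv_nonneg.mpr (by linarith)) _)]
      exact ENNReal.ofReal_le_ofReal (abs_ofDigits_sub_le_rpow h0 h1 hs has x y)
  rw [hrange, ENNReal.le_div_iff_mul_le (by simp [hs]) (by simp), one_mul] at hle
  exact hle

theorem sum_Icc_pow_sub (a : ℝ) (e : ℕ → ℕ) (n : ℕ) :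
    ∑ j ∈ Finset.Icc 1 n, (e j : ℝ) * (a ^ (j - 1) - a ^ j) =
      ∑ i ∈ Finset.range n, (e (i + 1) : ℝ) * (a ^ i * (1 - a)) := by
  induction n with
  | zero => simp
  | succ n ih =>
    rw [Finset.sum_Icc_succ_top (by lia), ih, Finset.sum_range_succ, Nat.add_sub_cancel]
    ring

theorem range_cantorPoint_subset {a : ℝ} (h0 : 0 < a) (h1 : a < 1) :
    range (cantorPoint a) ⊆ symCantorSet (a ^ ·) := by
  rintro _ ⟨d, rfl⟩
  refine mem_iInter.mpr fun n => mem_iUnion₂.mpr ⟨_, ⟨fun j => d (j - 1), fun j => ?_, rfl⟩, ?_⟩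
  · exact Nat.lt_succ_iff.mp (d (j - 1)).isLt
  · have hp : 0 < a ^ n := pow_pos h0 n
    rw [sum_Icc_pow_sub, cantorPoint_eq_sum_add h0 h1 d n]
    simp only [Nat.add_sub_cancel]
    exact ⟨le_add_of_nonneg_right (mul_nonneg hp.le (cantorPoint_nonneg h0 h1 _)),
      by gcongr; exact mul_le_of_le_one_right hp.le (cantorPoint_le_one h0 h1 _)⟩

theorem symStage_pow_subset (a : ℝ) (n : ℕ) :
    symStage (a ^ ·) n ⊆ ⋃ v : Fin n → Fin 2,
      Icc (∑ i, ((v i : ℕ) : ℝ) * (a ^ (i : ℕ) * (1 - a)))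
        (∑ i, ((v i : ℕ) : ℝ) * (a ^ (i : ℕ) * (1 - a)) + a ^ n) := by
  refine iUnion₂_subset ?_
  rintro _ ⟨e, he, rfl⟩
  rw [sum_Icc_pow_sub, Finset.sum_range]
  exact subset_iUnion_of_subset (fun i => ⟨e (i + 1), Nat.lt_succ_iff.mpr (he _)⟩) subset_rfl

theorem dimH_symCantorSet_pow_le {a : ℝ} (h0 : 0 < a) (h1 : a < 1) {s : ℝ} (hs : 0 < s)
    (has : a ^ s = 1 / 2) : dimH (symCantorSet (a ^ ·)) ≤ ENNReal.ofReal s := by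
  refine dimH_le_of_hausdorffMeasure_ne_top (d := s.toNNReal) (ne_top_of_le_ne_top
    ENNReal.one_ne_top ?_)
  rw [Real.coe_toNNReal s hs.le]
  have hr : Tendsto (fun n : ℕ => ENNReal.ofReal (a ^ n)) atTop (𝓝 0) := by
    simpa using ENNReal.tendsto_ofReal (tendsto_pow_atTop_nhds_zero_of_lt_one h0.le h1)
  refine (Measure.hausdorffMeasure_le_liminf_sum s _ _ hr
    (fun n (v : Fin n → Fin 2) => Icc (∑ i, ((v i : ℕ) : ℝ) * (a ^ (i : ℕ) * (1 - a)))
        (∑ i, ((v i : ℕ) : ℝ) * (a ^ (i : ℕ) * (1 - a)) + a ^ n))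
    (Eventually.of_forall fun n v => by simp [Real.ediam_Icc])
    (Eventually.of_forall fun n => (iInter_subset _ n).trans (symStage_pow_subset a n))).trans ?_
  have hsum : ∀ n : ℕ, (2 : ENNReal) ^ n * ENNReal.ofReal (a ^ n) ^ s = 1 := fun n => by
    rw [ENNReal.ofReal_rpow_of_pos (pow_pos h0 n), ← Real.rpow_natCast a n,
      ← Real.rpow_mul h0.le, mul_comm (n : ℝ), Real.rpow_mul h0.le, has, Real.rpow_natCast,
      ENNReal.ofReal_pow (by norm_num), ← mul_pow]
    simp [ENNReal.mul_inv_cancel]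
  simp [Real.ediam_Icc, hsum]

theorem dimH_symCantorSet_pow {a : ℝ} (h0 : 0 < a) (h1 : a < 1 / 2) :
    dimH (symCantorSet (a ^ ·)) = ENNReal.ofReal (Real.log 2 / -Real.log a) := by
  have hlog : Real.log a < 0 := Real.log_neg h0 (by linarith)
  have hs : 0 < Real.log 2 / -Real.log a := div_pos (Real.log_pos one_lt_two) (neg_pos.mpr hlog)
  have has : a ^ (Real.log 2 / -Real.log a) = 1 / 2 := by
    rw [Real.rpow_def_of_pos h0, div_neg, mul_neg, mul_div_cancel₀ _ hlog.ne, Real.exp_neg,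
      Real.exp_log two_pos, one_div]
  exact le_antisymm (dimH_symCantorSet_pow_le h0 (by linarith) hs has)
    ((le_dimH_range_cantorPoint h0 h1 hs has).trans
      (dimH_mono (range_cantorPoint_subset h0 (by linarith))))

/-- The middle-`β` Cantor set, `0 < β < 1`, has Hausdorff dimension
`log 2 / (log 2 - log (1 - β))`. -/
theorem dimH_middleBetaCantorSet (β : ℝ) (hβ0 : 0 < β) (hβ1 : β < 1) (c : ℕ → ℝ)
    (hc0 : c 0 = 1) (hc : ∀ k : ℕ, 1 ≤ k → c k = c (k - 1) * (1 - β) / 2) :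
    dimH (symCantorSet c) =
      ENNReal.ofReal (Real.log 2 / (Real.log 2 - Real.log (1 - β))) := by
  have hpow : c = (((1 - β) / 2) ^ ·) := by
    funext n
    induction n with
    | zero => simpa using hc0
    | succ n ih =>
      rw [hc (n + 1) (by lia), Nat.add_sub_cancel, ih]
      ring
  rw [hpow, dimH_symCantorSet_pow (by linarith) (by linarith),
    Real.log_div (by linarith) two_ne_zero, neg_sub]
end

section
/- Let 0 < λ < 1. Define c_0 = 1 and c_k = (c_{k−1} − λ·3^{−k})/2 for k ≥ 1. Then the λ-fat Cantor set C_λ = E(c) has Hausdorff dimension 1. -/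
open MeasureTheory

/-- The left endpoint obtained by moving right exactly at the steps in `A`. -/
noncomputable def symEndpoint (c : ℕ → ℝ) (A : Finset ℕ) : ℝ := ∑ j ∈ A, (c (j - 1) - c j)

/-- The union of the open gaps removed from stage `n` to obtain stage `n + 1`. -/
def symGap (c : ℕ → ℝ) (n : ℕ) : Set ℝ :=
  ⋃ A ∈ (Finset.Icc 1 n).powerset,
    Set.Ioo (symEndpoint c A + c (n + 1)) (symEndpoint c A + (c n - c (n + 1)))

theorem mem_symF_iff {c : ℕ → ℝ} {n : ℕ} {t : ℝ} :
    t ∈ symF c n ↔ ∃ A ∈ (Finset.Icc 1 n).powerset, t = symEndpoint c A := by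
  constructor
  · rintro ⟨ε, hε, rfl⟩
    refine ⟨(Finset.Icc 1 n).filter (fun j => ε j = 1),
      Finset.mem_powerset.2 (Finset.filter_subset _ _), ?_⟩
    rw [symEndpoint, Finset.sum_filter]
    refine Finset.sum_congr rfl fun j _ => ?_
    have := hε j
    interval_cases h : ε j <;> simp
  · rintro ⟨A, hA, rfl⟩
    refine ⟨fun j => if j ∈ A then 1 else 0, fun j => by dsimp only; split_ifs <;> simp, ?_⟩
    simp only [Nat.cast_ite, Nat.cast_one, Nat.cast_zero, ite_mul, one_mul, zero_mul]
    rw [← Finset.sum_filter, Finset.filter_mem_eq_inter,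
      Finset.inter_eq_right.2 (Finset.mem_powerset.1 hA), symEndpoint]

theorem symStage_subset_union_symGap (c : ℕ → ℝ) (n : ℕ) :
    symStage c n ⊆ symStage c (n + 1) ∪ symGap c n := by
  intro x hx
  simp only [symStage, Set.mem_iUnion, exists_prop] at hx
  obtain ⟨t, ht, hxt⟩ := hx
  obtain ⟨A, hA, rfl⟩ := mem_symF_iff.1 ht
  have hA' := Finset.mem_powerset.1 hA
  have hsub : Finset.Icc 1 n ⊆ Finset.Icc 1 (n + 1) :=
    Finset.Icc_subset_Icc_right n.le_succ
  by_cases h1 : x ≤ symEndpoint c A + c (n + 1)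
  · left
    simp only [symStage, Set.mem_iUnion, exists_prop]
    exact ⟨_, mem_symF_iff.2 ⟨A, Finset.mem_powerset.2 (hA'.trans hsub), rfl⟩, hxt.1, h1⟩
  by_cases h2 : symEndpoint c A + (c n - c (n + 1)) ≤ x
  · left
    have hn : n + 1 ∉ A := fun h => by
      have := Finset.mem_Icc.1 (hA' h)
      omega
    have he : symEndpoint c (insert (n + 1) A) = symEndpoint c A + (c n - c (n + 1)) := by
      rw [symEndpoint, Finset.sum_insert hn, add_comm, symEndpoint, Nat.add_sub_cancel]
    simp only [symStage, Set.mem_iUnion, exists_prop]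
    refine ⟨_, mem_symF_iff.2 ⟨insert (n + 1) A, Finset.mem_powerset.2 ?_, rfl⟩, ?_⟩
    · exact Finset.insert_subset (by simp) (hA'.trans hsub)
    · rw [he]
      exact ⟨h2, by linarith [hxt.2]⟩
  · right
    simp only [symGap, Set.mem_iUnion, exists_prop]
    exact ⟨A, hA, not_le.1 h1, not_le.1 h2⟩

theorem symStage_zero_subset (c : ℕ → ℝ) :
    symStage c 0 ⊆ symCantorSet c ∪ ⋃ n, symGap c n := by
  intro x hx
  by_cases hg : x ∈ ⋃ n, symGap c n
  · exact Or.inr hg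
  refine Or.inl (Set.mem_iInter.2 fun n => ?_)
  induction n with
  | zero => exact hx
  | succ n ih =>
    exact (symStage_subset_union_symGap c n ih).resolve_right
      fun h => hg (Set.mem_iUnion.2 ⟨n, h⟩)

theorem volume_symGap_le (c : ℕ → ℝ) (n : ℕ) :
    volume (symGap c n) ≤ ENNReal.ofReal (2 ^ n * (c n - 2 * c (n + 1))) := by
  refine (measure_biUnion_finset_le _ _).trans (le_of_eq ?_)
  have h (A : Finset ℕ) : symEndpoint c A + (c n - c (n + 1)) - (symEndpoint c A + c (n + 1))
      = c n - 2 * c (n + 1) := by ring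
  simp only [Real.volume_Ioo, h, Finset.sum_const, Finset.card_powerset, Nat.card_Icc,
    Nat.add_sub_cancel, nsmul_eq_mul]
  rw [ENNReal.ofReal_mul (by positivity), ENNReal.ofReal_pow (by norm_num)]
  simp

theorem Icc_subset_symStage_zero (c : ℕ → ℝ) : Set.Icc 0 (c 0) ⊆ symStage c 0 := by
  intro x hx
  simp only [symStage, Set.mem_iUnion, exists_prop]
  exact ⟨0, mem_symF_iff.2 ⟨∅, by simp, by simp [symEndpoint]⟩, by simpa using hx⟩

/-- The `λ`-fat Cantor set, `0 < λ < 1`, has Hausdorff dimension `1`. -/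
theorem dimH_fatCantorSet (l : ℝ) (hl0 : 0 < l) (hl1 : l < 1) (c : ℕ → ℝ)
    (hc0 : c 0 = 1) (hc : ∀ k : ℕ, 1 ≤ k → c k = (c (k - 1) - l / 3 ^ k) / 2) :
    dimH (symCantorSet c) = 1 := by
  refine le_antisymm ((dimH_mono (Set.subset_univ _)).trans_eq Real.dimH_univ) ?_
  suffices h : volume (symCantorSet c) ≠ 0 by
    have := le_dimH_of_hausdorffMeasure_ne_zero (s := symCantorSet c) (d := 1)
      (by rwa [NNReal.coe_one, hausdorffMeasure_real])
    simpa using this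
  intro h0
  have hgap (n : ℕ) : volume (symGap c n) ≤ ENNReal.ofReal (l / 3 * (2 / 3) ^ n) := by
    refine (volume_symGap_le c n).trans_eq ?_
    have := hc (n + 1) (by omega)
    rw [Nat.add_sub_cancel] at this
    rw [this, div_pow, pow_succ]
    congr 1
    field_simp
    ring
  have hsum : HasSum (fun n : ℕ => l / 3 * (2 / 3 : ℝ) ^ n) l := by
    have h := (hasSum_geometric_of_lt_one (r := (2 / 3 : ℝ)) (by norm_num) (by norm_num)).mul_left
      (l / 3)
    rwa [show l / 3 * (1 - 2 / 3 : ℝ)⁻¹ = l by ring] at h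
  have hle : (1 : ENNReal) ≤ ENNReal.ofReal l := by
    calc (1 : ENNReal) = volume (Set.Icc 0 (c 0)) := by simp [hc0]
      _ ≤ volume (symCantorSet c ∪ ⋃ n, symGap c n) :=
        measure_mono ((Icc_subset_symStage_zero c).trans (symStage_zero_subset c))
      _ ≤ volume (symCantorSet c) + ∑' n, volume (symGap c n) :=
        (measure_union_le _ _).trans (by gcongr; exact measure_iUnion_le _)
      _ ≤ ∑' n : ℕ, ENNReal.ofReal (l / 3 * (2 / 3) ^ n) := by
        rw [h0, zero_add]
        exact ENNReal.tsum_le_tsum hgap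
      _ = ENNReal.ofReal l := by
        rw [← ENNReal.ofReal_tsum_of_nonneg (fun n => by positivity) hsum.summable, hsum.tsum_eq]
  exact absurd (ENNReal.one_le_ofReal.1 hle) (not_le.2 hl1)
end
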